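/- Let (X, R) be a set system with |X| = n, and let δ₀ ∈ (0,1] and λ ∈ (0,1). If C is a (1−λ)-container family for (X, R^{≤δ₀n}), then the complement family C^(c) := {X \ C : C ∈ C} is a (λ−δ₀)-heavy (1−δ₀)-Mnet for (X, (R^{≤δ₀n})^(c)). -/

import Mathlib

open scoped Classical

/-- `M` is a `lam`-heavy `eps`-Mnet for the set system `(X, R)`. -/
def IsMnet {α : Type} [DecidableEq α] (X : Finset α) (R : Set (Finset α))
    (lam eps : ℝ) (M : Finset (Finset α)) : Prop :=
  ∀ S ∈ R, eps * (X.card : ℝ) ≤ (S.card : ℝ) →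
    ∃ m ∈ M, m ⊆ S ∧ lam * (S.card : ℝ) ≤ (m.card : ℝ)

/-- `C` is an `eps`-container for the set system `(X, R)`. -/
def IsContainer {α : Type} [DecidableEq α] (X : Finset α) (R : Set (Finset α))
    (eps : ℝ) (C : Finset (Finset α)) : Prop :=
  ∀ S ∈ R, ∃ c ∈ C, S ⊆ c ∧ ((c \ S).card : ℝ) ≤ eps * (X.card : ℝ)

/-- If `C` is a `(1-λ)`-container family for `(X, R^{≤δ₀n})`, then the complement family
`C^(c)` is a `(λ-δ₀)`-heavy `(1-δ₀)`-Mnet for `(X, (R^{≤δ₀n})^(c))`. -/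
theorem container_implies_mnet
    {α : Type} [DecidableEq α] (X : Finset α) (R : Set (Finset α)) (n : ℕ)
    (hn : X.card = n) (δ₀ lam : ℝ) (hδ₀ : 0 < δ₀) (hδ₀' : δ₀ ≤ 1)
    (hlam : 0 < lam) (hlam' : lam < 1)
    (C : Finset (Finset α))
    (hC : IsContainer X {S | S ∈ R ∧ (S.card : ℝ) ≤ δ₀ * (n : ℝ)} (1 - lam) C) :
    IsMnet X ((fun S => X \ S) '' {S | S ∈ R ∧ (S.card : ℝ) ≤ δ₀ * (n : ℝ)})
      (lam - δ₀) (1 - δ₀) (C.image (fun S => X \ S)) := by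
  subst hn
  rintro _ ⟨S, hS, rfl⟩ -
  obtain ⟨c, hcC, hSc, hc⟩ := hC S hS
  refine ⟨X \ c, Finset.mem_image_of_mem _ hcC, Finset.sdiff_subset_sdiff subset_rfl hSc, ?_⟩
  have hXc : (X.card : ℝ) ≤ (X \ c).card + c.card := by
    exact_mod_cast (Finset.card_le_card_sdiff_add_card (s := X) (t := c))
  have hcS : ((c \ S).card : ℝ) + S.card = c.card := by
    exact_mod_cast Finset.card_sdiff_add_card_eq_card hSc
  have hXS : ((X \ S).card : ℝ) ≤ X.card := by
    exact_mod_cast Finset.card_le_card Finset.sdiff_subset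
  obtain h | h := le_total δ₀ lam
  · calc (lam - δ₀) * ((X \ S).card : ℝ)
        ≤ (lam - δ₀) * X.card := mul_le_mul_of_nonneg_left hXS (sub_nonneg.2 h)
      _ ≤ (X \ c).card := by linarith [hS.2]
  · exact (mul_nonpos_of_nonpos_of_nonneg (sub_nonpos.2 h) (Nat.cast_nonneg _)).trans
      (Nat.cast_nonneg _)
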